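/- Suppose 1 ≤ n ≤ N+K−1 (so that the quantum integers [1],…,[n] are all nonzero). Then there exists a nonzero idempotent f_n in the Hecke algebra H_n (the Jones–Wenzl symmetrizer) such that σ_i f_n = f_n σ_i = q^{(N+1)/2N}·f_n for every i = 1,…,n−1, where q^{(N+1)/2N} is the root of the quadratic relation q^{−1/2N}x − q^{1/2N}x^{−1} = q^{1/2} − q^{−1/2} with positive sign. -/

import Mathlib

noncomputable section

/-- `qpow N K a = q^a = exp(2πi·a/(N+K))`, the fixed rational powers of
`q = exp(2πi/(N+K))`. -/
def qpow (N K : ℕ) (a : ℚ) : ℂ :=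
  Complex.exp (2 * (Real.pi : ℂ) * Complex.I * (a : ℂ) / ((N : ℂ) + (K : ℂ)))

/-- The group algebra over `ℂ` of the free group on generators indexed by `ι`:
the algebra with invertible generators `σ_i`, `i : ι`, and no further relations. -/
abbrev FreeAlg (ι : Type) := MonoidAlgebra ℂ (FreeGroup ι)

/-- The generator `σ_i` in the free algebra. -/
def genF {ι : Type} (i : ι) : FreeAlg ι := MonoidAlgebra.of ℂ (FreeGroup ι) (FreeGroup.of i)

/-- The inverse generator `σ_i⁻¹` in the free algebra. -/
def genFinv {ι : Type} (i : ι) : FreeAlg ι :=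
  MonoidAlgebra.of ℂ (FreeGroup ι) (FreeGroup.of i)⁻¹

/-- The defining relations of the Hecke algebra `H(N,K)` with generators `σ_i`, `i : ι`,
where `d : ι → ℕ` records the position of each generator (so `σ_i`, `σ_j` are adjacent when
`d i + 1 = d j`): the braid relations, distant commutation, and the quadratic relation
`q^{−1/2N}σ_i − q^{1/2N}σ_i^{−1} = (q^{1/2} − q^{−1/2})·1`. -/
inductive heckeRel (N K : ℕ) {ι : Type} (d : ι → ℕ) : FreeAlg ι → FreeAlg ι → Prop
  | braid (i j : ι) (h : d i + 1 = d j) :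
      heckeRel N K d (genF i * genF j * genF i) (genF j * genF i * genF j)
  | comm (i j : ι) (h : d i + 2 ≤ d j) :
      heckeRel N K d (genF i * genF j) (genF j * genF i)
  | quad (i : ι) :
      heckeRel N K d
        (qpow N K (-(1 / (2 * (N : ℚ)))) • genF i - qpow N K (1 / (2 * (N : ℚ))) • genFinv i)
        ((qpow N K (1 / 2) - qpow N K (-(1 / 2))) • (1 : FreeAlg ι))

/-- The Hecke algebra: the quotient of the group algebra of the free group by the
two-sided ideal (ring congruence) generated by the Hecke relations. -/
abbrev Hecke (N K : ℕ) {ι : Type} (d : ι → ℕ) := RingQuot (heckeRel N K d)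

/-- The generator `σ_i` of the Hecke algebra. -/
def σH (N K : ℕ) {ι : Type} (d : ι → ℕ) (i : ι) : Hecke N K d :=
  RingQuot.mkAlgHom ℂ (heckeRel N K d) (genF i)

/-- The Hecke algebra `H_n(N,K)` on generators `σ_1,…,σ_{n−1}`
(indexed by `Fin (n−1)`, with index `i` corresponding to `σ_{i+1}`). -/
abbrev HeckeFin (N K m : ℕ) := Hecke N K (fun i : Fin m => (i : ℕ))

/-- The generator `σ_{i+1}` of `H_n(N,K)`, `i : Fin (n−1)`. -/
def σFin (N K m : ℕ) (i : Fin m) : HeckeFin N K m :=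
  σH N K (fun j : Fin m => (j : ℕ)) i


theorem jw_left {A : Type*} [Ring A] [Algebra ℂ A] (q : ℂ) (M : ℕ) (T : ℕ → A)
    (hb : ∀ i, i + 1 < M → T i * T (i + 1) * T i = T (i + 1) * T i * T (i + 1))
    (hc : ∀ i j, i + 2 ≤ j → j < M → T i * T j = T j * T i)
    (hq : ∀ i, i < M → T i * T i = (q - 1) • T i + q • (1 : A))
    (hs : ∀ m, m ≤ M → ∑ k ∈ Finset.range (m + 1), q ^ k ≠ 0) (m : ℕ) (hm : m ≤ M) :
    ∃ (S : A) (s : ℂ), s ≠ 0 ∧ (∀ i, i < m → T i * S = q • S) ∧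
      ∀ φ : A →ₗ[ℂ] A, (∀ i, i < m → ∀ x, φ (T i * x) = q • φ x) → φ S = s • φ 1 := by
  induction m with
  | zero => exact ⟨1, 1, one_ne_zero, by simp, by simp⟩
  | succ m ih =>
    obtain ⟨S, s, hs0, hS, hφ⟩ := ih (by omega)
    let v : ℕ → A := fun k => Nat.rec S (fun k x => T (m - k) * x) k
    have v0 : v 0 = S := rfl
    have vs : ∀ k, v (k + 1) = T (m - k) * v k := fun k => rfl
    clear_value v
    have ha : ∀ k i, i + k < m → T i * v k = q • v k := by
      intro k
      induction k with
      | zero => intro i hi; rw [v0]; exact hS i (by omega)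
      | succ k ih =>
        intro i hi
        rw [vs, ← mul_assoc, hc i (m - k) (by omega) (by omega), mul_assoc, ih i (by omega),
          mul_smul_comm]
    have hd : ∀ k i, m + 1 < i + k → i ≤ m → k ≤ m + 1 → T i * v k = q • v k := by
      intro k
      induction k with
      | zero => intro i h1 h2 h3; omega
      | succ k ih =>
        intro i h1 h2 h3
        by_cases h : m + 1 < i + k
        · rw [vs, ← mul_assoc, ← hc (m - k) i (by omega) (by omega), mul_assoc,
            ih i h h2 (by omega), mul_smul_comm]
        · obtain ⟨k, rfl⟩ : ∃ k', k = k' + 1 := ⟨k - 1, by omega⟩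
          obtain ⟨i, rfl⟩ : ∃ i', i = i' + 1 := ⟨i - 1, by omega⟩
          have e1 : m - (k + 1) = i := by omega
          have e2 : m - k = i + 1 := by omega
          rw [vs, vs, e1, e2, ← mul_assoc, ← mul_assoc, ← hb i (by omega), mul_assoc,
            ha k i (by omega), mul_smul_comm, mul_assoc]
    refine ⟨∑ k ∈ Finset.range (m + 2), v k, (∑ k ∈ Finset.range (m + 2), q ^ k) * s,
      mul_ne_zero (hs (m + 1) hm) hs0, ?_, ?_⟩
    · intro i hi
      rw [← sub_eq_zero, Finset.mul_sum, Finset.smul_sum, ← Finset.sum_sub_distrib]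
      have hne : m - i ≠ m - i + 1 := by omega
      rw [← Finset.sum_subset (s₁ := {m - i, m - i + 1})]
      · rw [Finset.sum_pair hne, vs, show m - (m - i) = i by omega, ← mul_assoc, hq i (by omega),
          add_mul, smul_mul_assoc, smul_mul_assoc, one_mul, sub_smul, one_smul]
        abel
      · intro x hx
        simp only [Finset.mem_insert, Finset.mem_singleton] at hx
        rw [Finset.mem_range]; omega
      · intro x hx hx'
        simp only [Finset.mem_insert, Finset.mem_singleton, not_or] at hx'
        rw [Finset.mem_range] at hx
        rw [sub_eq_zero]
        by_cases h : i + x < m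
        · exact ha x i h
        · exact hd x i (by omega) (by omega) (by omega)
    · intro φ h
      have hv : ∀ k, φ (v k) = q ^ k • φ S := by
        intro k
        induction k with
        | zero => simp [v0]
        | succ k ih => rw [vs, h _ (by omega), ih, smul_smul, pow_succ']
      rw [map_sum, mul_smul, ← hφ φ (fun i hi => h i (by omega)), Finset.sum_smul]
      exact Finset.sum_congr rfl fun k _ => hv k

theorem jw_two {A : Type*} [Ring A] [Algebra ℂ A] (q : ℂ) (M : ℕ) (T : ℕ → A)
    (hb : ∀ i, i + 1 < M → T i * T (i + 1) * T i = T (i + 1) * T i * T (i + 1))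
    (hc : ∀ i j, i + 2 ≤ j → j < M → T i * T j = T j * T i)
    (hq : ∀ i, i < M → T i * T i = (q - 1) • T i + q • (1 : A))
    (hs : ∀ m, m ≤ M → ∑ k ∈ Finset.range (m + 1), q ^ k ≠ 0)
    (χ : A →ₐ[ℂ] ℂ) (hχ : ∀ i, i < M → χ (T i) = q) :
    ∃ f : A, f ≠ 0 ∧ f * f = f ∧ ∀ i, i < M → T i * f = q • f ∧ f * T i = q • f := by
  obtain ⟨S, s, hs0, hS, hφ⟩ := jw_left q M T hb hc hq hs M le_rfl
  obtain ⟨S', s', hs0', hS', hφ'⟩ := jw_left (A := Aᵐᵒᵖ) q M (fun i => MulOpposite.op (T i))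
    (by
      intro i hi
      have := congrArg MulOpposite.op (hb i hi)
      simpa [mul_assoc] using this)
    (by
      intro i j h1 h2
      have := congrArg MulOpposite.op (hc i j h1 h2)
      simpa using this.symm)
    (by
      intro i hi
      have := congrArg MulOpposite.op (hq i hi)
      simpa using this) hs M le_rfl
  obtain ⟨R, rfl⟩ : ∃ R, S' = MulOpposite.op R := ⟨S'.unop, rfl⟩
  have hR : ∀ i, i < M → R * T i = q • R := by
    intro i hi
    have := congrArg MulOpposite.unop (hS' i hi)
    simpa using this
  have key : ∀ Q : A, (∀ i, i < M → Q * T i = q • Q) → Q * S = s • Q := by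
    intro Q hQ
    have := hφ (LinearMap.mulLeft ℂ Q) (by
      intro i hi x
      simp [← mul_assoc, hQ i hi])
    simpa using this
  have key' : R * S = s' • S := by
    have := hφ' (LinearMap.mulLeft ℂ (MulOpposite.op S)) (by
      intro i hi x
      rw [LinearMap.mulLeft_apply, LinearMap.mulLeft_apply, ← mul_assoc, ← MulOpposite.op_mul,
        hS i hi, MulOpposite.op_smul, smul_mul_assoc])
    have := congrArg MulOpposite.unop this
    simpa using this
  have hSR : ∀ i, i < M → S * T i = q • S := by
    have e : S = (s'⁻¹ * s) • R := by
      rw [mul_smul, ← key R hR, key', inv_smul_smul₀ hs0']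
    intro i hi
    rw [e, smul_mul_assoc, hR i hi, smul_comm]
  refine ⟨s⁻¹ • S, ?_, ?_, ?_⟩
  · intro h0
    have hS0 : S = 0 := by
      rcases smul_eq_zero.1 h0 with h | h
      · exact absurd (inv_eq_zero.1 h) hs0
      · exact h
    have := hφ ((Algebra.linearMap ℂ A).comp χ.toLinearMap) (by
      intro i hi x
      simp [hχ i hi, Algebra.smul_def])
    rw [hS0, map_zero] at this
    have := congrArg χ this
    simp at this
    exact hs0 this.symm
  · rw [smul_mul_smul_comm, key S hSR, smul_smul, mul_assoc, inv_mul_cancel₀ hs0, mul_one]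
  · intro i hi
    rw [mul_smul_comm, smul_mul_assoc, hS i hi, hSR i hi, smul_comm]
    exact ⟨rfl, rfl⟩

theorem qpow_add' (N K : ℕ) (a b : ℚ) : qpow N K a * qpow N K b = qpow N K (a + b) := by
  unfold qpow
  rw [← Complex.exp_add]
  congr 1
  push_cast
  ring

theorem qpow_zero' (N K : ℕ) : qpow N K 0 = 1 := by simp [qpow]

theorem qpow_ne' (N K : ℕ) (a : ℚ) : qpow N K a ≠ 0 := Complex.exp_ne_zero _

theorem qpow_pow' (N K k : ℕ) : qpow N K 1 ^ k = qpow N K k := by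
  induction k with
  | zero => simp [qpow_zero']
  | succ k ih => rw [pow_succ, ih, qpow_add']; push_cast; rfl

theorem qpow_ne_one' (N K k : ℕ) (h1 : 1 ≤ k) (h2 : k < N + K) : qpow N K k ≠ 1 := by
  intro h
  unfold qpow at h
  rw [Complex.exp_eq_one_iff] at h
  obtain ⟨n, hn⟩ := h
  have hNK : ((N : ℂ) + K) ≠ 0 := by
    have : ((N + K : ℕ) : ℂ) ≠ 0 := by rw [Nat.cast_ne_zero]; omega
    simpa using this
  have hpi : (2 * (Real.pi : ℂ) * Complex.I) ≠ 0 := Complex.two_pi_I_ne_zero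
  rw [div_eq_iff hNK] at hn
  have : (k : ℂ) = n * (N + K) := by
    apply mul_left_cancel₀ hpi
    push_cast at hn
    rw [hn]; ring
  have h3 : (k : ℤ) = n * (N + K) := by exact_mod_cast this
  have hn0 : 0 < n := by
    by_contra hcon
    have : n * ((N : ℤ) + K) ≤ 0 := mul_nonpos_of_nonpos_of_nonneg (by omega) (by omega)
    omega
  nlinarith

theorem hecke_char (N K m : ℕ) (hN : 2 ≤ N) : ∃ χ : HeckeFin N K m →ₐ[ℂ] ℂ,
    ∀ i, χ (σFin N K m i) = qpow N K (((N : ℚ) + 1) / (2 * N)) := by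
  have hN0 : (N : ℚ) ≠ 0 := by rw [Nat.cast_ne_zero]; omega
  let u : ℂˣ := Units.mk0 (qpow N K (((N : ℚ) + 1) / (2 * N))) (qpow_ne' _ _ _)
  let g : FreeAlg (Fin m) →ₐ[ℂ] ℂ := MonoidAlgebra.lift ℂ ℂ (FreeGroup (Fin m))
    ((Units.coeHom ℂ).comp (FreeGroup.lift (fun _ => u)))
  have g1 : ∀ i, g (genF i) = qpow N K (((N : ℚ) + 1) / (2 * N)) := by
    intro i; simp [g, genF, u]
  have g2 : ∀ i, g (genFinv i) = qpow N K (-(((N : ℚ) + 1) / (2 * N))) := by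
    intro i
    have : g (genFinv i) = (qpow N K (((N : ℚ) + 1) / (2 * N)))⁻¹ := by
      simp [g, genFinv, u]
    rw [this]
    apply inv_eq_of_mul_eq_one_right
    rw [qpow_add', add_neg_cancel, qpow_zero']
  refine ⟨RingQuot.liftAlgHom ℂ ⟨g, ?_⟩, ?_⟩
  · intro x y h
    cases h with
    | braid i j h => simp only [map_mul, g1]
    | comm i j h => simp only [map_mul, g1]
    | quad i =>
      simp only [map_sub, map_smul, g1, g2, map_one, smul_eq_mul, mul_one, qpow_add']
      congr 2 <;> (field_simp; ring)
  · intro i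
    unfold σFin σH
    rw [RingQuot.liftAlgHom_mkAlgHom_apply]
    exact g1 i

theorem hecke_sq (N K m : ℕ) (i : Fin m) :
    σFin N K m i * σFin N K m i =
      (qpow N K (1 / (2 * (N : ℚ))) * (qpow N K (1 / 2) - qpow N K (-(1 / 2)))) • σFin N K m i
        + qpow N K (1 / (N : ℚ)) • (1 : HeckeFin N K m) := by
  have h := RingQuot.mkAlgHom_rel ℂ (heckeRel.quad (N := N) (K := K)
    (d := fun i : Fin m => (i : ℕ)) i)
  have hinv : RingQuot.mkAlgHom ℂ (heckeRel N K (fun i : Fin m => (i : ℕ))) (genFinv i)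
      * σFin N K m i = 1 := by
    unfold σFin σH genF genFinv
    rw [← map_mul, ← map_mul, inv_mul_cancel, map_one, map_one]
  rw [map_sub, map_smul, map_smul, map_smul, map_one] at h
  change _ • σFin N K m i - _ = _ at h
  have h2 := congrArg (fun x => qpow N K (1 / (2 * (N : ℚ))) • (x * σFin N K m i)) h
  simp only [sub_mul, smul_mul_assoc, hinv, smul_sub, smul_smul, qpow_add', one_mul] at h2
  rw [add_neg_cancel, qpow_zero', one_smul, sub_eq_iff_eq_add] at h2
  rw [h2]
  congr 3
  ring

/-- Suppose `1 ≤ n ≤ N+K−1` (so that the quantum integers `[1],…,[n]` are all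
nonzero).  Then there exists a nonzero idempotent `f_n` in the Hecke algebra `H_n`
(the Jones–Wenzl symmetrizer) such that `σ_i f_n = f_n σ_i = q^{(N+1)/2N}·f_n` for every
`i = 1,…,n−1`. -/
theorem statement6 (N K n : ℕ) (hN : 2 ≤ N) (hK : 1 ≤ K)
    (hn1 : 1 ≤ n) (hn2 : n ≤ N + K - 1) :
    ∃ f : HeckeFin N K (n - 1),
      f ≠ 0 ∧ f * f = f ∧
        ∀ i : Fin (n - 1),
          σFin N K (n - 1) i * f = qpow N K (((N : ℚ) + 1) / (2 * N)) • f ∧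
            f * σFin N K (n - 1) i = qpow N K (((N : ℚ) + 1) / (2 * N)) • f := by
  have hN0 : (N : ℚ) ≠ 0 := by rw [Nat.cast_ne_zero]; omega
  obtain ⟨χ, hχ⟩ := hecke_char N K (n - 1) hN
  set c := qpow N K (((N : ℚ) - 1) / (2 * N)) with hc
  have hc0 : c ≠ 0 := qpow_ne' _ _ _
  have hcl : c * qpow N K (((N : ℚ) + 1) / (2 * N)) = qpow N K 1 := by
    rw [hc, qpow_add']; congr 1; field_simp; ring
  have hT : ∀ i (h : i < n - 1), (fun i => if h : i < n - 1 then c • σFin N K (n - 1) ⟨i, h⟩ else 0) i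
      = c • σFin N K (n - 1) ⟨i, h⟩ := fun i h => dif_pos h
  generalize (fun i => if h : i < n - 1 then c • σFin N K (n - 1) ⟨i, h⟩ else 0) = T at hT
  obtain ⟨f, hf0, hff, hf⟩ := jw_two (qpow N K 1) (n - 1) T
    (by
      intro i hi
      rw [hT i (by omega), hT (i + 1) hi]
      have := RingQuot.mkAlgHom_rel ℂ (heckeRel.braid (N := N) (K := K)
        (d := fun i : Fin (n - 1) => (i : ℕ)) ⟨i, by omega⟩ ⟨i + 1, hi⟩ rfl)
      simp only [map_mul] at this
      simp only [smul_mul_smul_comm]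
      exact congrArg _ this)
    (by
      intro i j h hj
      rw [hT i (by omega), hT j hj]
      have := RingQuot.mkAlgHom_rel ℂ (heckeRel.comm (N := N) (K := K)
        (d := fun i : Fin (n - 1) => (i : ℕ)) ⟨i, by omega⟩ ⟨j, hj⟩ h)
      simp only [map_mul] at this
      simp only [smul_mul_smul_comm]
      exact congrArg _ this)
    (by
      intro i hi
      rw [hT i hi, smul_mul_smul_comm, hecke_sq, smul_add, smul_smul, smul_smul, smul_smul]
      congr 2
      · rw [hc]
        simp only [mul_sub, sub_mul, qpow_add', one_mul]
        congr 1 <;> congr 1 <;> (field_simp; ring)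
      · rw [hc]
        simp only [qpow_add']
        congr 1; field_simp; ring)
    (by
      intro m hm h0
      have := geom_sum_mul (qpow N K 1) (m + 1)
      rw [h0, zero_mul, qpow_pow'] at this
      exact qpow_ne_one' N K (m + 1) (by omega) (by omega) (sub_eq_zero.1 this.symm))
    χ
    (by
      intro i hi
      rw [hT i hi, map_smul, hχ, smul_eq_mul, hcl])
  refine ⟨f, hf0, hff, fun i => ?_⟩
  obtain ⟨h1, h2⟩ := hf i i.2
  rw [hT i i.2, ← hcl, mul_smul, smul_mul_assoc] at h1
  rw [hT i i.2, ← hcl, mul_smul, mul_smul_comm] at h2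
  exact ⟨smul_right_injective _ hc0 h1, smul_right_injective _ hc0 h2⟩
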